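/- For every rational q ≠ 0 with boundary triple (l, q, r) ∈ B in the Stern–Brocot tree: l is the maximum of the set of strict ancestors of q that are smaller than q (and l = −∞ if no ancestor of q is smaller than q), and r is the minimum of the set of strict ancestors of q that are greater than q (and r = ∞ if no ancestor of q is greater than q). -/

import Mathlib

/-- Fractions are pairs `(numerator, denominator)` of integers; `(-1,0)` is `-∞`, `(1,0)` is `∞`. -/
def mediant (p q : ℤ × ℤ) : ℤ × ℤ := (p.1 + q.1, p.2 + q.2)

/-- The Stern–Brocot boundary relation `B`: `SBB l m r` means `(l, m, r) ∈ B`. -/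
inductive SBB : ℤ × ℤ → ℤ × ℤ → ℤ × ℤ → Prop
  | base : SBB (-1, 0) (0, 1) (1, 0)
  | left {l m r : ℤ × ℤ} : SBB l m r → SBB l (mediant l m) m
  | right {l m r : ℤ × ℤ} : SBB l m r → SBB m (mediant m r) r

/-- One step down the Stern–Brocot tree; the state is the triple
(left bound, node, right bound); `false` is an L-move, `true` an R-move. -/
def sbStep : (ℤ × ℤ) × (ℤ × ℤ) × (ℤ × ℤ) → Bool → (ℤ × ℤ) × (ℤ × ℤ) × (ℤ × ℤ)
  | (l, m, _r), false => (l, mediant l m, m)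
  | (_l, m, r), true => (m, mediant m r, r)

/-- Boundary triple of the node reached from the root `0/1` by the path `s ∈ {L,R}*`. -/
def sbTriple (s : List Bool) : (ℤ × ℤ) × (ℤ × ℤ) × (ℤ × ℤ) :=
  s.foldl sbStep ((-1, 0), (0, 1), (1, 0))

/-- The (numerator, denominator) of the node reached by the path `s`. -/
def sbNode (s : List Bool) : ℤ × ℤ := (sbTriple s).2.1

/-- The rational number at the node of the Stern–Brocot tree reached by the path `s`. -/
def sbVal (s : List Bool) : ℚ := ((sbNode s).1 : ℚ) / ((sbNode s).2 : ℚ)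

/-- The path (string in {L,R}*) whose run-length encoding is the block list `l`,
the first block being in direction `b` (`true` = R, `false` = L). -/
def pathOf (b : Bool) : List ℕ → List Bool
  | [] => []
  | a :: rest => List.replicate a b ++ pathOf (!b) rest

/-- `s` is the path of a convergent fraction of the node with path `t`:
either `s = t`, or `s` corresponds to the first `m` blocks (1 ≤ m ≤ n) of the
run-length (SB-)encoding of `t`. -/
def ConvPath (s t : List Bool) : Prop :=
  s = t ∨ ∃ (b : Bool) (l : List ℕ) (m : ℕ),
    (∀ a ∈ l, 0 < a) ∧ 0 < m ∧ m ≤ l.length ∧ t = pathOf b l ∧ s = pathOf b (l.take m)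

/-- `s` is the path of a strict convergent fraction of the node with path `t`. -/
def StrictConvPath (s t : List Bool) : Prop :=
  ∃ (b : Bool) (l : List ℕ) (m : ℕ),
    (∀ a ∈ l, 0 < a) ∧ 0 < m ∧ m < l.length ∧ t = pathOf b l ∧ s = pathOf b (l.take m)

/-- `p` is a convergent fraction of `r` in the Stern–Brocot tree. -/
def ConvOf (p r : ℚ) : Prop := ∃ s t : List Bool, sbVal s = p ∧ sbVal t = r ∧ ConvPath s t

/-- `r` is a (strict) ancestor of `p` in the Stern–Brocot tree, i.e. `p` is a descendant of `r`. -/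
def IsAncestor (r p : ℚ) : Prop := ∃ s t : List Bool, sbVal s = r ∧ t ≠ [] ∧ sbVal (s ++ t) = p

/-- `(p, q)` is an edge of the Stern–Brocot tree, `q` a child of `p`. -/
def IsEdge (p q : ℚ) : Prop := ∃ (s : List Bool) (d : Bool), sbVal s = p ∧ sbVal (s ++ [d]) = q

/-- An interval of `ℚ`: a nonempty order-convex set. -/
def IsInterval (I : Set ℚ) : Prop :=
  I.Nonempty ∧ ∀ p ∈ I, ∀ q ∈ I, ∀ r : ℚ, p < r → r < q → r ∈ I

/-- An interval partition of `ℚ`: a list of intervals, pointwise increasing, covering `ℚ`. -/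
def IsIntervalPartition (P : List (Set ℚ)) : Prop :=
  (∀ I ∈ P, IsInterval I) ∧
  P.Pairwise (fun I J => ∀ p ∈ I, ∀ q ∈ J, p < q) ∧
  (∀ x : ℚ, ∃ I ∈ P, x ∈ I)

/-- `I` is monochromatic with respect to `γ`: `γ` is constant on `I`. -/
def Monochromatic {S : Type*} (γ : ℚ → S) (I : Set ℚ) : Prop :=
  ∀ p ∈ I, ∀ q ∈ I, γ p = γ q

/-- `γ` is a finite piecewise function. -/
def FinitePW {S : Type*} (γ : ℚ → S) : Prop :=
  ∃ P : List (Set ℚ), IsIntervalPartition P ∧ ∀ I ∈ P, Monochromatic γ I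

/-- `P` is the canonical representation of `γ`: an interval partition into monochromatic
pieces on which `γ` takes different constant values on adjacent pieces. -/
def IsCanonicalRep {S : Type*} (γ : ℚ → S) (P : List (Set ℚ)) : Prop :=
  IsIntervalPartition P ∧ (∀ I ∈ P, Monochromatic γ I) ∧
  P.Chain' (fun I J => ∀ p ∈ I, ∀ q ∈ J, γ p ≠ γ q)

/-- `x ∈ bounds(γ)`: `x` is a (rational) infimum or supremum of an interval of the
canonical representation of `γ`. -/
def IsBound {S : Type*} (γ : ℚ → S) (x : ℚ) : Prop :=
  ∃ P, IsCanonicalRep γ P ∧ ∃ I ∈ P, IsGLB I x ∨ IsLUB I x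

/-- `x` is a left-bound of `γ`: the minimum of some interval of the canonical representation. -/
def IsLeftBound {S : Type*} (γ : ℚ → S) (x : ℚ) : Prop :=
  ∃ P, IsCanonicalRep γ P ∧ ∃ I ∈ P, IsLeast I x

/-- `x` is a right-bound of `γ`: the maximum of some interval of the canonical representation. -/
def IsRightBound {S : Type*} (γ : ℚ → S) (x : ℚ) : Prop :=
  ∃ P, IsCanonicalRep γ P ∧ ∃ I ∈ P, IsGreatest I x

/-- `(p, q)` is a break link of `γ`: an edge of the Stern–Brocot tree such that `p = 0/1`
or the unordered closed interval `⟦p, q⟧` is not monochromatic w.r.t. `γ`. -/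
def IsBreakLink {S : Type*} (γ : ℚ → S) (p q : ℚ) : Prop :=
  IsEdge p q ∧ (p = 0 ∨ ¬ Monochromatic γ (Set.uIcc p q))

/-- `cfval [a₁,…,aₙ] = a₁ + 1/(a₂ + 1/(⋯ + 1/(aₙ + 1)))`. -/
def cfval : List ℕ → ℚ
  | [] => 1
  | [a] => (a : ℚ) + 1
  | a :: b :: rest => (a : ℚ) + 1 / cfval (b :: rest)

theorem sbTriple_append_singleton (s : List Bool) (d : Bool) :
    sbTriple (s ++ [d]) = sbStep (sbTriple s) d := by
  simp [sbTriple, List.foldl_append]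

/-- Denominators along the tree are nonnegative (positive at the nodes) and every node lies
strictly between its two bounds. -/
theorem sbTriple_bounds (s : List Bool) :
    0 < (sbTriple s).2.1.2 ∧ 0 ≤ (sbTriple s).1.2 ∧ 0 ≤ (sbTriple s).2.2.2 ∧
    (sbTriple s).1.1 * (sbTriple s).2.1.2 < (sbTriple s).2.1.1 * (sbTriple s).1.2 ∧
    (sbTriple s).2.1.1 * (sbTriple s).2.2.2 < (sbTriple s).2.2.1 * (sbTriple s).2.1.2 := by
  induction s using List.reverseRecOn with
  | nil => simp [sbTriple]
  | append_singleton s d ih =>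
    rw [sbTriple_append_singleton]
    revert ih
    obtain ⟨⟨a, b⟩, ⟨c, e⟩, ⟨f, g⟩⟩ := sbTriple s
    intro ih
    cases d <;> simp only [sbStep, mediant] at ih ⊢ <;>
      refine ⟨by omega, by omega, by omega, ?_, ?_⟩ <;> linarith

/-- Transitivity of the order on fractions, written with cross-multiplication, where the
middle denominator may vanish. -/
theorem cross_mul_le_trans {a b c d e f : ℤ} (hb : 0 < b) (hd : 0 ≤ d) (hf : 0 < f)
    (h₁ : a * d < c * b) (h₂ : c * f ≤ e * d) : a * f ≤ e * b := by
  rcases hd.eq_or_lt with rfl | hd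
  · have hc : 0 < c := by
      by_contra! hc
      nlinarith
    nlinarith
  · refine le_of_mul_le_mul_right ?_ hd
    nlinarith

theorem prefix_append_singleton_and_ne {t s : List Bool} {d : Bool} :
    (t <+: s ++ [d] ∧ t ≠ s ++ [d]) ↔ t = s ∨ (t <+: s ∧ t ≠ s) := by
  rw [List.prefix_concat_iff]
  constructor
  · tauto
  · rintro (rfl | ⟨h, -⟩)
    · simp
    · refine ⟨Or.inr h, ?_⟩
      rintro rfl
      simpa using h.length_le

/-- No strict ancestor lies strictly between the two bounds of a node. -/
theorem sbNode_prefix_outside_bounds (s t : List Bool) (ht : t <+: s) (hne : t ≠ s) :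
    (sbNode t).1 * (sbTriple s).1.2 ≤ (sbTriple s).1.1 * (sbNode t).2 ∨
    (sbTriple s).2.2.1 * (sbNode t).2 ≤ (sbNode t).1 * (sbTriple s).2.2.2 := by
  induction s using List.reverseRecOn with
  | nil => exact absurd (List.prefix_nil.mp ht) hne
  | append_singleton s d ih =>
    have hn : 0 < (sbNode t).2 := (sbTriple_bounds t).1
    rw [sbTriple_append_singleton]
    rcases prefix_append_singleton_and_ne.mp ⟨ht, hne⟩ with rfl | ⟨h, h'⟩
    · cases d
      · exact Or.inr le_rfl
      · exact Or.inl le_rfl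
    · have ih := ih h h'
      obtain ⟨hm, hl, hr, hlm, hmr⟩ := sbTriple_bounds s
      cases d
      · exact ih.imp_right (cross_mul_le_trans hm hr hn hmr)
      · refine ih.imp_left fun hnl => ?_
        have := cross_mul_le_trans (a := -(sbTriple s).2.1.1) (c := -(sbTriple s).1.1)
          (e := -(sbNode t).1) hm hl hn (by linarith) (by linarith)
        change (sbNode t).1 * (sbTriple s).2.1.2 ≤ (sbTriple s).2.1.1 * (sbNode t).2
        linarith

/-- Each finite bound of a node is one of its strict ancestors. -/
theorem sbTriple_bounds_are_ancestors (s : List Bool) :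
    ((sbTriple s).1.2 ≠ 0 → ∃ t, (t <+: s ∧ t ≠ s) ∧ sbNode t = (sbTriple s).1) ∧
    ((sbTriple s).2.2.2 ≠ 0 → ∃ t, (t <+: s ∧ t ≠ s) ∧ sbNode t = (sbTriple s).2.2) := by
  induction s using List.reverseRecOn with
  | nil => simp [sbTriple]
  | append_singleton s d ih =>
    simp only [prefix_append_singleton_and_ne, sbTriple_append_singleton]
    cases d
    · exact ⟨fun h => (ih.1 h).imp fun t ht => ⟨Or.inr ht.1, ht.2⟩,
        fun _ => ⟨s, Or.inl rfl, rfl⟩⟩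
    · exact ⟨fun _ => ⟨s, Or.inl rfl, rfl⟩,
        fun h => (ih.2 h).imp fun t ht => ⟨Or.inr ht.1, ht.2⟩⟩

theorem int_div_le_div_iff {a b c d : ℤ} (hb : 0 < b) (hd : 0 < d) :
    (a : ℚ) / b ≤ (c : ℚ) / d ↔ a * d ≤ c * b := by
  rw [div_le_div_iff₀ (by exact_mod_cast hb) (by exact_mod_cast hd)]
  exact_mod_cast Iff.rfl

theorem int_div_lt_div_iff {a b c d : ℤ} (hb : 0 < b) (hd : 0 < d) :
    (a : ℚ) / b < (c : ℚ) / d ↔ a * d < c * b := by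
  rw [div_lt_div_iff₀ (by exact_mod_cast hb) (by exact_mod_cast hd)]
  exact_mod_cast Iff.rfl

/-- A strict ancestor smaller than a node is at most its left bound. -/
theorem sbNode_le_left_of_lt {s t : List Bool} (ht : t <+: s) (hne : t ≠ s)
    (h : sbVal t < sbVal s) :
    (sbNode t).1 * (sbTriple s).1.2 ≤ (sbTriple s).1.1 * (sbNode t).2 := by
  obtain ⟨hm, -, hr, -, hmr⟩ := sbTriple_bounds s
  have hn : 0 < (sbNode t).2 := (sbTriple_bounds t).1
  refine (sbNode_prefix_outside_bounds s t ht hne).resolve_right fun hrn => h.not_ge ?_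
  exact (int_div_le_div_iff hm hn).mpr (cross_mul_le_trans hm hr hn hmr hrn)

/-- A strict ancestor greater than a node is at least its right bound. -/
theorem right_le_sbNode_of_lt {s t : List Bool} (ht : t <+: s) (hne : t ≠ s)
    (h : sbVal s < sbVal t) :
    (sbTriple s).2.2.1 * (sbNode t).2 ≤ (sbNode t).1 * (sbTriple s).2.2.2 := by
  obtain ⟨hm, hl, -, hlm, -⟩ := sbTriple_bounds s
  have hn : 0 < (sbNode t).2 := (sbTriple_bounds t).1
  refine (sbNode_prefix_outside_bounds s t ht hne).resolve_left fun hnl => h.not_ge ?_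
  refine (int_div_le_div_iff hn hm).mpr ?_
  have := cross_mul_le_trans (a := -(sbTriple s).2.1.1) (c := -(sbTriple s).1.1)
    (e := -(sbNode t).1) hm hl hn (by linarith) (by linarith)
  change (sbNode t).1 * (sbTriple s).2.1.2 ≤ (sbTriple s).2.1.1 * (sbNode t).2
  linarith

/-- for every rational `q ≠ 0` (node at a nonempty path `s`) with boundary
triple `(l, q, r) ∈ B`: `l` is the greatest strict ancestor of `q` smaller than `q`
(and if `l = -∞`, i.e. its denominator is `0`, then no strict ancestor of `q` is smaller
than `q`), and symmetrically `r` is the least strict ancestor of `q` greater than `q`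
(`r = ∞` iff none is greater). Strict ancestors of `q` are the nodes at proper prefixes
of `s`. -/
theorem boundary_is_extremal_ancestor (s : List Bool) (hs : s ≠ []) :
    (((sbTriple s).1.2 = 0 → ∀ t : List Bool, t <+: s → t ≠ s → ¬ sbVal t < sbVal s) ∧
     ((sbTriple s).1.2 ≠ 0 →
        IsGreatest {x : ℚ | ∃ t : List Bool, t <+: s ∧ t ≠ s ∧ sbVal t = x ∧ x < sbVal s}
          (((sbTriple s).1.1 : ℚ) / (((sbTriple s).1.2 : ℤ) : ℚ)))) ∧
    (((sbTriple s).2.2.2 = 0 → ∀ t : List Bool, t <+: s → t ≠ s → ¬ sbVal s < sbVal t) ∧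
     ((sbTriple s).2.2.2 ≠ 0 →
        IsLeast {x : ℚ | ∃ t : List Bool, t <+: s ∧ t ≠ s ∧ sbVal t = x ∧ sbVal s < x}
          (((sbTriple s).2.2.1 : ℚ) / (((sbTriple s).2.2.2 : ℤ) : ℚ)))) := by
  obtain ⟨hm, hl, hr, hlm, hmr⟩ := sbTriple_bounds s
  obtain ⟨hla, hra⟩ := sbTriple_bounds_are_ancestors s
  refine ⟨⟨fun h0 t ht hne hlt => ?_, fun h0 => ⟨?_, ?_⟩⟩,
    ⟨fun h0 t ht hne hlt => ?_, fun h0 => ⟨?_, ?_⟩⟩⟩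
  · have hn : 0 < (sbNode t).2 := (sbTriple_bounds t).1
    have := sbNode_le_left_of_lt ht hne hlt
    rw [h0] at this hlm
    nlinarith
  · obtain ⟨t, ⟨ht, hne⟩, htl⟩ := hla h0
    exact ⟨t, ht, hne, by rw [sbVal, htl],
      (int_div_lt_div_iff (hl.lt_of_ne' h0) hm).mpr hlm⟩
  · rintro _ ⟨t, ht, hne, rfl, hlt⟩
    exact (int_div_le_div_iff (sbTriple_bounds t).1 (hl.lt_of_ne' h0)).mpr
      (sbNode_le_left_of_lt ht hne hlt)
  · have hn : 0 < (sbNode t).2 := (sbTriple_bounds t).1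
    have := right_le_sbNode_of_lt ht hne hlt
    rw [h0] at this hmr
    nlinarith
  · obtain ⟨t, ⟨ht, hne⟩, htr⟩ := hra h0
    exact ⟨t, ht, hne, by rw [sbVal, htr],
      (int_div_lt_div_iff hm (hr.lt_of_ne' h0)).mpr hmr⟩
  · rintro _ ⟨t, ht, hne, rfl, hlt⟩
    exact (int_div_le_div_iff (hr.lt_of_ne' h0) (sbTriple_bounds t).1).mpr
      (right_le_sbNode_of_lt ht hne hlt)
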